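/- arXiv:2309.14196 — 3 statements merged into one kernel-verified Lean document; each statement's English description precedes it below -/
import Mathlib

section
/- Let (J,f,g) be a ferromagnetic RBM with n visible and m hidden nodes, and let u ∈ [n] be a visible node. The discrete influence function S ↦ I_u(S) is monotone: for all S ⊆ T ⊆ [n]\{u}, I_u(S) ≤ I_u(T). -/
open Finset

noncomputable section

/-- The set of `±1` configurations on `n` nodes. -/
def cube (n : ℕ) : Finset (Fin n → ℤ) :=
  Fintype.piFinset fun _ => ({1, -1} : Finset ℤ)

/-- Unnormalized Boltzmann weight `exp(xᵀJy + fᵀx + gᵀy)` of an RBM `(J, f, g)`. -/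
def rbmWeight {n m : ℕ} (J : Matrix (Fin n) (Fin m) ℝ) (f : Fin n → ℝ) (g : Fin m → ℝ)
    (x : Fin n → ℤ) (y : Fin m → ℤ) : ℝ :=
  Real.exp ((∑ i, ∑ j, (x i : ℝ) * J i j * (y j : ℝ)) +
    (∑ i, f i * (x i : ℝ)) + (∑ j, g j * (y j : ℝ)))

/-- Partition function of the RBM. -/
def rbmZ {n m : ℕ} (J : Matrix (Fin n) (Fin m) ℝ) (f : Fin n → ℝ) (g : Fin m → ℝ) : ℝ :=
  ∑ x ∈ cube n, ∑ y ∈ cube m, rbmWeight J f g x y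

/-- Visible marginal probability `P(X = x) = Σ_y P(X = x, Y = y)`. -/
def visP {n m : ℕ} (J : Matrix (Fin n) (Fin m) ℝ) (f : Fin n → ℝ) (g : Fin m → ℝ)
    (x : Fin n → ℤ) : ℝ :=
  (∑ y ∈ cube m, rbmWeight J f g x y) / rbmZ J f g

/-- Probability of a set `A` of visible configurations under the visible marginal. -/
def visPr {n m : ℕ} (J : Matrix (Fin n) (Fin m) ℝ) (f : Fin n → ℝ) (g : Fin m → ℝ)
    (A : Finset (Fin n → ℤ)) : ℝ :=
  ∑ x ∈ A, visP J f g x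

/-- The event `X_S = c|_S` (visible configurations agreeing with `c` on `S`). -/
def eventS {n : ℕ} (S : Finset (Fin n)) (c : Fin n → ℤ) : Finset (Fin n → ℤ) :=
  (cube n).filter fun x => ∀ j ∈ S, x j = c j

/-- Conditional expectation `E[F(X) | X_S = c|_S]` under the visible marginal. -/
def condExpVis {n m : ℕ} (J : Matrix (Fin n) (Fin m) ℝ) (f : Fin n → ℝ) (g : Fin m → ℝ)
    (F : (Fin n → ℤ) → ℝ) (S : Finset (Fin n)) (c : Fin n → ℤ) : ℝ :=
  (∑ x ∈ eventS S c, F x * visP J f g x) / visPr J f g (eventS S c)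

/-- The discrete influence function `I_u(S) = E[X_u | X_S = 1^{|S|}]`. -/
def influence {n m : ℕ} (J : Matrix (Fin n) (Fin m) ℝ) (f : Fin n → ℝ) (g : Fin m → ℝ)
    (u : Fin n) (S : Finset (Fin n)) : ℝ :=
  condExpVis J f g (fun x => (x u : ℝ)) S (fun _ => 1)

/-- `X_u` and `X_j` are conditionally independent given `X_S`, under the visible marginal. -/
def condIndep {n m : ℕ} (J : Matrix (Fin n) (Fin m) ℝ) (f : Fin n → ℝ) (g : Fin m → ℝ)
    (u j : Fin n) (S : Finset (Fin n)) : Prop :=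
  ∀ c ∈ cube n, ∀ a ∈ ({1, -1} : Finset ℤ), ∀ b ∈ ({1, -1} : Finset ℤ),
    visPr J f g ((eventS S c).filter fun x => x u = a ∧ x j = b) *
        visPr J f g (eventS S c) =
      visPr J f g ((eventS S c).filter fun x => x u = a) *
        visPr J f g ((eventS S c).filter fun x => x j = b)

/-- Conditioned on `X_S`, `X_u` is independent of every other visible node. -/
def separatesNode {n m : ℕ} (J : Matrix (Fin n) (Fin m) ℝ) (f : Fin n → ℝ) (g : Fin m → ℝ)
    (u : Fin n) (S : Finset (Fin n)) : Prop :=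
  ∀ j : Fin n, j ∉ S → j ≠ u → condIndep J f g u j S

/-- `N` is the two-hop neighborhood `N₂(u)`: the smallest set `S ⊆ [n] \ {u}` such that,
conditioned on `X_S`, `X_u` is conditionally independent of every other visible node. -/
def isTwoHopNbhd {n m : ℕ} (J : Matrix (Fin n) (Fin m) ℝ) (f : Fin n → ℝ) (g : Fin m → ℝ)
    (u : Fin n) (N : Finset (Fin n)) : Prop :=
  u ∉ N ∧ separatesNode J f g u N ∧
    ∀ S : Finset (Fin n), u ∉ S → separatesNode J f g u S → N ⊆ S

/-- Conditional covariance `Cov(u, v | X_S = c|_S)` under the visible marginal. -/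
def condCov {n m : ℕ} (J : Matrix (Fin n) (Fin m) ℝ) (f : Fin n → ℝ) (g : Fin m → ℝ)
    (u v : Fin n) (S : Finset (Fin n)) (c : Fin n → ℤ) : ℝ :=
  condExpVis J f g (fun x => (x u : ℝ) * (x v : ℝ)) S c -
    condExpVis J f g (fun x => (x u : ℝ)) S c * condExpVis J f g (fun x => (x v : ℝ)) S c

/-- Average conditional covariance `Cov^avg(u, v | S) = E_{x_S}[Cov(u, v | x_S)]`, the sum over
the configurations of `S` (canonically extended by `1` off `S`) of
`P(X_S = x_S) · Cov(u, v | x_S)`. -/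
def avgCondCov {n m : ℕ} (J : Matrix (Fin n) (Fin m) ℝ) (f : Fin n → ℝ) (g : Fin m → ℝ)
    (u v : Fin n) (S : Finset (Fin n)) : ℝ :=
  ∑ c ∈ (cube n).filter (fun c => ∀ j ∉ S, c j = 1),
    visPr J f g (eventS S c) * condCov J f g u v S c

end

/-- For `J ≥ 0`, the exponent of the Boltzmann weight is supermodular, so the weight satisfies the
FKG lattice condition. -/
theorem rbmWeight_mul_le_inf_sup {n m : ℕ} (J : Matrix (Fin n) (Fin m) ℝ)
    (f : Fin n → ℝ) (g : Fin m → ℝ) (hJ : ∀ i j, 0 ≤ J i j)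
    (x x' : Fin n → ℤ) (y y' : Fin m → ℤ) :
    rbmWeight J f g x y * rbmWeight J f g x' y' ≤
      rbmWeight J f g (x ⊓ x') (y ⊓ y') * rbmWeight J f g (x ⊔ x') (y ⊔ y') := by
  have bilin : ∀ (c : ℝ) (a a' b b' : ℤ), 0 ≤ c →
      (a : ℝ) * c * b + a' * c * b' ≤
        ((a ⊓ a' : ℤ) : ℝ) * c * ((b ⊓ b' : ℤ) : ℝ) +
          ((a ⊔ a' : ℤ) : ℝ) * c * ((b ⊔ b' : ℤ) : ℝ) := by
    intro c a a' b b' hc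
    rcases le_total a a' with h | h <;> rcases le_total b b' with h' | h' <;>
      simp only [inf_of_le_left, inf_of_le_right, sup_of_le_left, sup_of_le_right, h, h'] <;>
      have h₁ : (_ : ℝ) ≤ _ := Int.cast_le.mpr h <;>
      have h₂ : (_ : ℝ) ≤ _ := Int.cast_le.mpr h' <;>
      nlinarith [mul_nonneg hc (mul_nonneg (sub_nonneg.mpr h₁) (sub_nonneg.mpr h₂))]
  have lin : ∀ (c : ℝ) (a a' : ℤ), c * a + c * a' =
      c * ((a ⊓ a' : ℤ) : ℝ) + c * ((a ⊔ a' : ℤ) : ℝ) := by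
    intro c a a'
    rcases le_total a a' with h | h <;> simp [h, add_comm]
  have hxy := Finset.sum_le_sum fun i (_ : i ∈ univ) =>
    Finset.sum_le_sum fun j (_ : j ∈ univ) =>
      bilin (J i j) (x i) (x' i) (y j) (y' j) (hJ i j)
  have hx := Finset.sum_congr rfl fun i (_ : i ∈ univ) => lin (f i) (x i) (x' i)
  have hy := Finset.sum_congr rfl fun j (_ : j ∈ univ) => lin (g j) (y j) (y' j)
  simp only [Finset.sum_add_distrib] at hxy hx hy
  unfold rbmWeight
  rw [← Real.exp_add, ← Real.exp_add, Real.exp_le_exp]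
  simp only [Pi.inf_apply, Pi.sup_apply]
  linarith

theorem mem_cube {n : ℕ} {x : Fin n → ℤ} : x ∈ cube n ↔ ∀ i, x i = 1 ∨ x i = -1 := by
  simp [cube]

theorem inf_mem_cube {n : ℕ} {x y : Fin n → ℤ} (hx : x ∈ cube n) (hy : y ∈ cube n) :
    x ⊓ y ∈ cube n := by
  rw [mem_cube] at *
  intro i
  rcases hx i with h | h <;> rcases hy i with h' | h' <;> simp [h, h']

theorem sup_mem_cube {n : ℕ} {x y : Fin n → ℤ} (hx : x ∈ cube n) (hy : y ∈ cube n) :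
    x ⊔ y ∈ cube n := by
  rw [mem_cube] at *
  intro i
  rcases hx i with h | h <;> rcases hy i with h' | h' <;> simp [h, h']

open scoped FinsetFamily in
/-- Conditioning on `X_T = 1` instead of `X_S = 1`, with `S ⊆ T`, increases the weighted average
of every nonnegative monotone function. -/
theorem sum_eventS_mul_le_of_subset {n m : ℕ} (J : Matrix (Fin n) (Fin m) ℝ)
    (f : Fin n → ℝ) (g : Fin m → ℝ) (hJ : ∀ i j, 0 ≤ J i j)
    {φ : (Fin n → ℤ) → ℝ} (hφ₀ : 0 ≤ φ) (hφ : Monotone φ)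
    {S T : Finset (Fin n)} (hST : S ⊆ T) :
    (∑ x ∈ eventS S fun _ => 1, φ x * ∑ y ∈ cube m, rbmWeight J f g x y) *
        (∑ x ∈ eventS T fun _ => 1, ∑ y ∈ cube m, rbmWeight J f g x y) ≤
      (∑ x ∈ eventS S fun _ => 1, ∑ y ∈ cube m, rbmWeight J f g x y) *
        (∑ x ∈ eventS T fun _ => 1, φ x * ∑ y ∈ cube m, rbmWeight J f g x y) := by
  classical
  have hw : ∀ x y, 0 ≤ rbmWeight J f g x y := fun _ _ => (Real.exp_pos _).le
  let w : (Fin n → ℤ) × (Fin m → ℤ) → ℝ := fun p => rbmWeight J f g p.1 p.2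
  let v : (Fin n → ℤ) × (Fin m → ℤ) → ℝ := fun p => φ p.1 * rbmWeight J f g p.1 p.2
  have hw₀ : 0 ≤ w := fun p => hw _ _
  have hv₀ : 0 ≤ v := fun p => mul_nonneg (hφ₀ _) (hw _ _)
  have key := four_functions_theorem v w w v hv₀ hw₀ hw₀ hv₀
    (fun a b => by
      calc φ a.1 * rbmWeight J f g a.1 a.2 * rbmWeight J f g b.1 b.2
          = φ a.1 * (rbmWeight J f g a.1 a.2 * rbmWeight J f g b.1 b.2) := mul_assoc _ _ _
        _ ≤ φ (a.1 ⊔ b.1) * (rbmWeight J f g (a.1 ⊓ b.1) (a.2 ⊓ b.2) *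
              rbmWeight J f g (a.1 ⊔ b.1) (a.2 ⊔ b.2)) :=
            mul_le_mul (hφ le_sup_left) (rbmWeight_mul_le_inf_sup J f g hJ _ _ _ _)
              (mul_nonneg (hw _ _) (hw _ _)) (hφ₀ _)
        _ = rbmWeight J f g (a.1 ⊓ b.1) (a.2 ⊓ b.2) *
              (φ (a.1 ⊔ b.1) * rbmWeight J f g (a.1 ⊔ b.1) (a.2 ⊔ b.2)) :=
            mul_left_comm _ _ _)
    ((eventS S fun _ => 1) ×ˢ cube m) ((eventS T fun _ => 1) ×ˢ cube m)
  have hinf : ((eventS S fun _ => 1) ×ˢ cube m) ⊼ ((eventS T fun _ => 1) ×ˢ cube m) ⊆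
      (eventS S fun _ => 1) ×ˢ cube m := by
    rw [Finset.infs_subset_iff]
    rintro ⟨x, y⟩ h ⟨x', y'⟩ h'
    simp only [mem_product, eventS, mem_filter] at h h'
    simp only [Prod.mk_inf_mk, mem_product, eventS, mem_filter]
    refine ⟨⟨inf_mem_cube h.1.1 h'.1.1, fun j hj => ?_⟩, inf_mem_cube h.2 h'.2⟩
    simp [h.1.2 j hj, h'.1.2 j (hST hj)]
  have hsup : ((eventS S fun _ => 1) ×ˢ cube m) ⊻ ((eventS T fun _ => 1) ×ˢ cube m) ⊆
      (eventS T fun _ => 1) ×ˢ cube m := by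
    rw [Finset.sups_subset_iff]
    rintro ⟨x, y⟩ h ⟨x', y'⟩ h'
    simp only [mem_product, eventS, mem_filter] at h h'
    simp only [Prod.mk_sup_mk, mem_product, eventS, mem_filter]
    refine ⟨⟨sup_mem_cube h.1.1 h'.1.1, fun j hj => ?_⟩, sup_mem_cube h.2 h'.2⟩
    rcases mem_cube.1 h.1.1 j with hx | hx <;> simp [hx, h'.1.2 j hj]
  have key' := key.trans (mul_le_mul
    (Finset.sum_le_sum_of_subset_of_nonneg hinf fun p _ _ => hw₀ p)
    (Finset.sum_le_sum_of_subset_of_nonneg hsup fun p _ _ => hv₀ p)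
    (Finset.sum_nonneg fun p _ => hv₀ p) (Finset.sum_nonneg fun p _ => hw₀ p))
  simpa only [Finset.sum_product, w, v, Finset.mul_sum] using key'

/-- The partition function cancels in conditional expectations. -/
theorem condExpVis_eq_div {n m : ℕ} (J : Matrix (Fin n) (Fin m) ℝ) (f : Fin n → ℝ)
    (g : Fin m → ℝ) (F : (Fin n → ℤ) → ℝ) (S : Finset (Fin n)) (c : Fin n → ℤ) :
    condExpVis J f g F S c =
      (∑ x ∈ eventS S c, F x * ∑ y ∈ cube m, rbmWeight J f g x y) /
        ∑ x ∈ eventS S c, ∑ y ∈ cube m, rbmWeight J f g x y := by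
  have one_mem : ∀ k, (fun _ => 1 : Fin k → ℤ) ∈ cube k := fun k => by simp [mem_cube]
  have hZ : 0 < rbmZ J f g :=
    Finset.sum_pos (fun x _ => Finset.sum_pos (fun y _ => Real.exp_pos _) ⟨_, one_mem m⟩)
      ⟨_, one_mem n⟩
  simp only [condExpVis, visPr, visP, ← mul_div_assoc, ← Finset.sum_div]
  exact div_div_div_cancel_right₀ hZ.ne' _ _

theorem sum_eventS_one_pos {n m : ℕ} (J : Matrix (Fin n) (Fin m) ℝ) (f : Fin n → ℝ)
    (g : Fin m → ℝ) (S : Finset (Fin n)) :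
    0 < ∑ x ∈ eventS S fun _ => 1, ∑ y ∈ cube m, rbmWeight J f g x y :=
  Finset.sum_pos
    (fun x _ => Finset.sum_pos (fun y _ => Real.exp_pos _) ⟨fun _ => 1, by simp [mem_cube]⟩)
    ⟨fun _ => 1, by simp [eventS, mem_cube]⟩

/-- For a ferromagnetic RBM `(J, f, g)` and a visible node `u`, the discrete
influence function `S ↦ I_u(S)` is monotone: `I_u(S) ≤ I_u(T)` for all `S ⊆ T ⊆ [n] \ {u}`. -/
theorem influence_monotone {n m : ℕ} (J : Matrix (Fin n) (Fin m) ℝ)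
    (f : Fin n → ℝ) (g : Fin m → ℝ)
    (hJ : ∀ i j, 0 ≤ J i j) (hf : ∀ i, 0 ≤ f i) (hg : ∀ j, 0 ≤ g j)
    (u : Fin n) (S T : Finset (Fin n)) (hST : S ⊆ T) (hu : u ∉ T) :
    influence J f g u S ≤ influence J f g u T := by
  rw [influence, influence, condExpVis_eq_div, condExpVis_eq_div,
    div_le_div_iff₀ (sum_eventS_one_pos J f g S) (sum_eventS_one_pos J f g T)]
  let φ : (Fin n → ℤ) → ℝ := fun x => max ((x u : ℝ) + 1) 0
  have hφ : Monotone φ := fun x y hxy =>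
    max_le_max_right 0 (add_le_add_left (Int.cast_le.mpr (hxy u)) 1)
  have hφ_sum : ∀ R : Finset (Fin n),
      ∑ x ∈ eventS R fun _ => 1, φ x * ∑ y ∈ cube m, rbmWeight J f g x y =
        (∑ x ∈ eventS R fun _ => 1, (x u : ℝ) * ∑ y ∈ cube m, rbmWeight J f g x y) +
          ∑ x ∈ eventS R fun _ => 1, ∑ y ∈ cube m, rbmWeight J f g x y := by
    intro R
    rw [← Finset.sum_add_distrib]
    refine Finset.sum_congr rfl fun x hx => ?_
    have hxu : φ x = x u + 1 := by
      rcases mem_cube.1 (Finset.mem_filter.1 hx).1 u with h | h <;> norm_num [φ, h]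
    rw [hxu, add_one_mul]
  have key := sum_eventS_mul_le_of_subset J f g hJ (φ := φ) (fun x => le_max_right _ _) hφ hST
  rw [hφ_sum, hφ_sum] at key
  linarith
end

section
/- Let (J,f,g) be a ferromagnetic RBM with n visible and m hidden nodes, and let u ∈ [n] be a visible node. The discrete influence function S ↦ I_u(S) is submodular: for all S ⊆ T ⊆ [n]\{u} and every j ∈ [n]\(T ∪ {u}), I_u(S ∪ {j}) − I_u(S) ≥ I_u(T ∪ {j}) − I_u(T). -/
open Finset

open Filter Topology in
/-- A limit of the numbers `∑ a (1 + e / N) ^ N`, all of them nonnegative, is nonnegative. -/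
theorem sum_mul_exp_nonneg {Ω : Type*} (s : Finset Ω) (a e : Ω → ℝ)
    (h : ∀ N : ℕ, 0 ≤ ∑ x ∈ s, a x * (1 + e x / N) ^ N) :
    0 ≤ ∑ x ∈ s, a x * Real.exp (e x) := by
  have hlim : Tendsto (fun N : ℕ => ∑ x ∈ s, a x * (1 + e x / N) ^ N) atTop
      (𝓝 (∑ x ∈ s, a x * Real.exp (e x))) :=
    tendsto_finsetSum _ fun x _ => (Real.tendsto_one_add_div_pow_exp (e x)).const_mul _
  exact ge_of_tendsto' hlim h

/-- The `±1` configurations on an arbitrary finite vertex set. -/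
def spinConf (V : Type*) [Fintype V] [DecidableEq V] : Finset (V → ℤ) :=
  Fintype.piFinset fun _ => ({1, -1} : Finset ℤ)

/-- The `4 × 4` Hadamard matrix of the Ellis–Monroe–Newman change of variables. -/
def hadamardRow : Fin 4 → Fin 4 → ℝ :=
  ![![1, 1, 1, 1], ![1, 1, -1, -1], ![1, -1, 1, -1], ![-1, 1, 1, -1]]

/-- The `k`-th rotated spin built from four replicas of a single spin. -/
def rotSpin (k : Fin 4) (q : Fin 4 → ℤ) : ℝ :=
  ∑ r, hadamardRow k r * (q r : ℝ)

theorem sum_mul_eq_rotSpin (p q : Fin 4 → ℤ) :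
    ∑ r, (p r : ℝ) * (q r : ℝ) = (1 / 4) * ∑ k, rotSpin k p * rotSpin k q := by
  simp [rotSpin, hadamardRow, Fin.sum_univ_four]
  ring

theorem sum_spinConf_four (F : (Fin 4 → ℤ) → ℝ) :
    ∑ q ∈ spinConf (Fin 4), F q =
      ∑ a ∈ ({1, -1} : Finset ℤ), ∑ b ∈ ({1, -1} : Finset ℤ), ∑ c ∈ ({1, -1} : Finset ℤ),
        ∑ d ∈ ({1, -1} : Finset ℤ), F ![a, b, c, d] := by
  simp only [← Finset.sum_product']
  refine Finset.sum_nbij' (fun q => (q 0, q 1, q 2, q 3))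
    (fun p => ![p.1, p.2.1, p.2.2.1, p.2.2.2]) ?_ ?_ ?_ ?_ ?_
  · intro q hq
    have := Fintype.mem_piFinset.1 hq
    simp only [Finset.mem_product]
    exact ⟨this 0, this 1, this 2, this 3⟩
  · rintro ⟨a, b, c, d⟩ h
    simp only [Finset.mem_product] at h
    refine Fintype.mem_piFinset.2 fun r => ?_
    fin_cases r
    exacts [h.1, h.2.1, h.2.2.1, h.2.2.2]
  · intro q _
    ext r
    fin_cases r <;> rfl
  · rintro ⟨a, b, c, d⟩ _
    rfl
  · intro q _
    congr 1
    ext r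
    fin_cases r <;> rfl

/-- All mixed moments of the rotated spins at one site are nonnegative. -/
theorem site_moment_nonneg (w : ℤ → ℝ) (h0 : 0 ≤ w (-1)) (h1 : w (-1) ≤ w 1) (p : Fin 4 → ℕ) :
    0 ≤ ∑ q ∈ spinConf (Fin 4), (∏ r, w (q r)) * ∏ k, rotSpin k q ^ p k := by
  have hne : (1 : ℤ) ≠ -1 := by decide
  rw [sum_spinConf_four]
  simp only [Finset.sum_pair hne, Fin.prod_univ_four, rotSpin, hadamardRow, Fin.sum_univ_four]
  simp only [Fin.isValue, Matrix.cons_val_zero, Matrix.cons_val_one, Matrix.cons_val]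
  generalize w (-1) = v at *
  generalize w 1 = u at *
  generalize p 0 = a, p 1 = b, p 2 = c, p 3 = d
  norm_num
  have hu : 0 ≤ u := h0.trans h1
  have key : 0 ≤ u * u * u * v - u * v * v * v := by
    have : u * u * u * v - u * v * v * v = u * v * ((u - v) * (u + v)) := by ring
    rw [this]
    have := sub_nonneg.2 h1
    positivity
  have key4 : 0 ≤ u * u * u * u - v * v * v * v := by
    have : u * u * u * u - v * v * v * v = (u - v) * (u + v) * (u * u + v * v) := by ring
    rw [this]
    have := sub_nonneg.2 h1
    positivity
  have hA : 0 ≤ (4 : ℝ) ^ a * 0 ^ b * 0 ^ c * 0 ^ d := by positivity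
  have hB : 0 ≤ (0 : ℝ) ^ a * 4 ^ b * 0 ^ c * 0 ^ d := by positivity
  have hC : 0 ≤ (0 : ℝ) ^ a * 0 ^ b * 4 ^ c * 0 ^ d := by positivity
  have hD : 0 ≤ (0 : ℝ) ^ a * 0 ^ b * 0 ^ c * 4 ^ d := by positivity
  have hE : 0 ≤ (2 : ℝ) ^ a * 2 ^ b * 2 ^ c * 2 ^ d := by positivity
  have uv : 0 ≤ u * v * u * v := by positivity
  have v4 : 0 ≤ v * v * v * v := by positivity
  have v3 : 0 ≤ u * v * v * v := by positivity
  have e1 := mul_nonneg v4 hA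
  have e2 := mul_nonneg key4 hA
  have e3 := mul_nonneg v3 hE
  have e4 := mul_nonneg key hE
  have e5 := mul_nonneg uv hB
  have e6 := mul_nonneg uv hC
  have e7 := mul_nonneg uv hD
  rcases Nat.even_or_odd a with ha | ha <;> rcases Nat.even_or_odd b with hb | hb <;>
    rcases Nat.even_or_odd c with hc | hc <;> rcases Nat.even_or_odd d with hd | hd <;>
    simp only [ha.neg_pow, hb.neg_pow, hc.neg_pow, hd.neg_pow] <;>
    generalize (0 : ℝ) ^ a = a0, (0 : ℝ) ^ b = b0, (0 : ℝ) ^ c = c0, (0 : ℝ) ^ d = d0,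
      (2 : ℝ) ^ a = a2, (2 : ℝ) ^ b = b2, (2 : ℝ) ^ c = c2, (2 : ℝ) ^ d = d2,
      (4 : ℝ) ^ a = a4, (4 : ℝ) ^ b = b4, (4 : ℝ) ^ c = c4, (4 : ℝ) ^ d = d4 at *
  all_goals linarith only [e1, e2, e3, e4, e5, e6, e7]

theorem replica_moment_expand {Ω : Type*} (s : Finset Ω) (μ x y z : Ω → ℝ) (b c d : Fin 4 → ℝ) :
    ∑ σ ∈ Fintype.piFinset (fun _ : Fin 4 => s), (∏ r, μ (σ r)) *
        ((∑ r, b r * x (σ r)) * ((∑ r, c r * y (σ r)) * ∑ r, d r * z (σ r))) =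
      ∑ i, ∑ j, ∑ k, b i * c j * d k * ∏ r, ∑ a ∈ s,
        μ a * ((if i = r then x a else 1) * ((if j = r then y a else 1) *
          (if k = r then z a else 1))) := by
  simp only [Finset.prod_univ_sum, Finset.prod_mul_distrib, Finset.prod_ite_eq,
    Finset.mem_univ, if_true]
  symm
  simp_rw [Finset.mul_sum, Finset.sum_comm (s := (Finset.univ : Finset (Fin 4)))
    (t := Fintype.piFinset (fun _ : Fin 4 => s))]
  refine Finset.sum_congr rfl fun σ _ => ?_
  simp only [Finset.sum_mul, Finset.mul_sum]
  simp only [Fin.sum_univ_four]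
  ring

theorem hadamard_covariance {Ω : Type*} (s : Finset Ω) (μ x y : Ω → ℝ) :
    ∑ σ ∈ Fintype.piFinset (fun _ : Fin 4 => s), (∏ r, μ (σ r)) *
        ((∑ r, hadamardRow 1 r * x (σ r)) * ∑ r, hadamardRow 1 r * y (σ r)) =
      4 * (∑ a ∈ s, μ a) ^ 2 * ((∑ a ∈ s, μ a) * (∑ a ∈ s, μ a * (x a * y a))
        - (∑ a ∈ s, μ a * x a) * (∑ a ∈ s, μ a * y a)) := by
  have h := replica_moment_expand s μ x y (fun _ => 1) (hadamardRow 1) (hadamardRow 1)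
    ![1, 0, 0, 0]
  simp only [Fin.sum_univ_four, Fin.prod_univ_four, hadamardRow, Matrix.cons_val,
    Matrix.cons_val_zero, Matrix.cons_val_one, Fin.isValue, Fin.reduceEq, if_true, if_false,
    mul_one, one_mul, mul_zero, zero_mul, add_zero, ite_self] at h ⊢
  rw [h]
  ring

theorem hadamard_cumulant {Ω : Type*} (s : Finset Ω) (μ x y z : Ω → ℝ) :
    ∑ σ ∈ Fintype.piFinset (fun _ : Fin 4 => s), (∏ r, μ (σ r)) *
        ((∑ r, hadamardRow 1 r * x (σ r)) * ((∑ r, hadamardRow 2 r * y (σ r)) *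
          ∑ r, hadamardRow 3 r * z (σ r))) =
      -4 * (∑ a ∈ s, μ a) * ((∑ a ∈ s, μ a) ^ 2 * (∑ a ∈ s, μ a * (x a * (y a * z a)))
        - (∑ a ∈ s, μ a) * ((∑ a ∈ s, μ a * x a) * (∑ a ∈ s, μ a * (y a * z a))
          + (∑ a ∈ s, μ a * y a) * (∑ a ∈ s, μ a * (x a * z a))
          + (∑ a ∈ s, μ a * z a) * (∑ a ∈ s, μ a * (x a * y a)))
        + 2 * (∑ a ∈ s, μ a * x a) * (∑ a ∈ s, μ a * y a) * (∑ a ∈ s, μ a * z a)) := by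
  rw [replica_moment_expand]
  simp only [Fin.sum_univ_four, Fin.prod_univ_four, hadamardRow, Matrix.cons_val,
    Matrix.cons_val_zero, Matrix.cons_val_one, Fin.isValue, Fin.reduceEq, if_true, if_false,
    mul_one, one_mul]
  ring

section Replicas

variable {V : Type*} [Fintype V]

/-- The ferromagnetic pair energy of four replicas. -/
def replicaEnergy (K : V → V → ℝ) (σ : Fin 4 → V → ℤ) : ℝ :=
  ∑ r, ∑ v, ∑ v', K v v' * ((σ r v : ℝ) * (σ r v' : ℝ))

theorem replicaEnergy_eq (K : V → V → ℝ) (σ : Fin 4 → V → ℤ) :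
    replicaEnergy K σ = ∑ v, ∑ v', ∑ k, K v v' * (1 / 4) *
      (rotSpin k (fun r => σ r v) * rotSpin k (fun r => σ r v')) := by
  unfold replicaEnergy
  rw [Finset.sum_comm]
  refine Finset.sum_congr rfl fun v _ => ?_
  rw [Finset.sum_comm]
  refine Finset.sum_congr rfl fun v' _ => ?_
  rw [← Finset.mul_sum, sum_mul_eq_rotSpin (fun r => σ r v) (fun r => σ r v'),
    ← Finset.mul_sum, mul_assoc]

/-- Unnormalized Ising weight with pair couplings `K` and single-site weights `w`. -/
noncomputable def isingWeight (K : V → V → ℝ) (w : V → ℤ → ℝ) (z : V → ℤ) : ℝ :=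
  (∏ v, w v (z v)) * Real.exp (∑ v, ∑ v', K v v' * ((z v : ℝ) * (z v' : ℝ)))

theorem prod_isingWeight (K : V → V → ℝ) (w : V → ℤ → ℝ) (σ : Fin 4 → V → ℤ) :
    ∏ r, isingWeight K w (σ r) =
      (∏ v, ∏ r, w v (σ r v)) * Real.exp (replicaEnergy K σ) := by
  simp only [isingWeight, Finset.prod_mul_distrib, replicaEnergy, Real.exp_sum]
  rw [Finset.prod_comm]

variable [DecidableEq V]

/-- Four independent configurations on the vertex set `V`. -/
def replicaConf (V : Type*) [Fintype V] [DecidableEq V] : Finset (Fin 4 → V → ℤ) :=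
  Fintype.piFinset fun _ => spinConf V

theorem sum_replicaConf_prod (h : V → (Fin 4 → ℤ) → ℝ) :
    ∑ σ ∈ replicaConf V, ∏ v, h v (fun r => σ r v) =
      ∏ v, ∑ q ∈ spinConf (Fin 4), h v q := by
  rw [Finset.prod_univ_sum]
  refine Finset.sum_nbij' (fun σ v r => σ r v) (fun τ r v => τ v r) ?_ ?_ ?_ ?_ ?_
  · intro σ hσ
    simp only [replicaConf, spinConf, Fintype.mem_piFinset] at hσ ⊢
    exact fun v r => hσ r v
  · intro τ hτ
    simp only [replicaConf, spinConf, Fintype.mem_piFinset] at hτ ⊢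
    exact fun r v => hτ v r
  all_goals intros; rfl

/-- `F` pairs nonnegatively with every monomial in the rotated spins, with respect to the
weight `W` on four replicas. -/
def PairsNonneg (W F : (Fin 4 → V → ℤ) → ℝ) : Prop :=
  ∀ e : V → Fin 4 → ℕ, 0 ≤ ∑ σ ∈ replicaConf V,
    W σ * (∏ v, ∏ k, rotSpin k (fun r => σ r v) ^ e v k) * F σ

theorem PairsNonneg.add {W F G : (Fin 4 → V → ℤ) → ℝ} (hF : PairsNonneg W F)
    (hG : PairsNonneg W G) : PairsNonneg W (fun σ => F σ + G σ) := by
  intro e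
  simp only [mul_add, Finset.sum_add_distrib]
  exact add_nonneg (hF e) (hG e)

theorem PairsNonneg.const_mul {W F : (Fin 4 → V → ℤ) → ℝ} {c : ℝ} (hc : 0 ≤ c)
    (hF : PairsNonneg W F) : PairsNonneg W (fun σ => c * F σ) := by
  intro e
  simp only [mul_left_comm _ c, ← Finset.mul_sum]
  exact mul_nonneg hc (hF e)

theorem PairsNonneg.sum {ι : Type*} {W : (Fin 4 → V → ℤ) → ℝ} (s : Finset ι)
    {F : ι → (Fin 4 → V → ℤ) → ℝ} (hF : ∀ i, PairsNonneg W (F i)) :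
    PairsNonneg W (fun σ => ∑ i ∈ s, F i σ) := by
  intro e
  simp only [Finset.mul_sum]
  rw [Finset.sum_comm]
  exact Finset.sum_nonneg fun i _ => hF i e

theorem PairsNonneg.rotSpin_mul {W F : (Fin 4 → V → ℤ) → ℝ} (hF : PairsNonneg W F)
    (v : V) (k : Fin 4) : PairsNonneg W (fun σ => rotSpin k (fun r => σ r v) * F σ) := by
  intro e
  refine (hF (e + Pi.single v (Pi.single k 1))).trans_eq (Finset.sum_congr rfl fun σ _ => ?_)
  have h : ∏ v', ∏ k', rotSpin k' (fun r => σ r v') ^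
      ((Pi.single v (Pi.single k 1) : V → Fin 4 → ℕ) v' k') = rotSpin k (fun r => σ r v) := by
    rw [Finset.prod_eq_single v, Finset.prod_eq_single k]
    · simp
    · intro k' _ hk
      simp [hk]
    · simp
    · intro v' _ hv
      simp [hv]
    · simp
  simp only [Pi.add_apply, pow_add, Finset.prod_mul_distrib, h]
  ring

theorem PairsNonneg.replicaEnergy_mul {W F : (Fin 4 → V → ℤ) → ℝ} (hF : PairsNonneg W F)
    {K : V → V → ℝ} (hK : ∀ v v', 0 ≤ K v v') :
    PairsNonneg W (fun σ => replicaEnergy K σ * F σ) := by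
  simp only [replicaEnergy_eq, Finset.sum_mul]
  refine PairsNonneg.sum _ fun v => PairsNonneg.sum _ fun v' => PairsNonneg.sum _ fun k => ?_
  simp only [mul_assoc]
  exact (((hF.rotSpin_mul v' k).rotSpin_mul v k).const_mul (by norm_num)).const_mul (hK v v')

theorem PairsNonneg.exp_replicaEnergy {W : (Fin 4 → V → ℤ) → ℝ}
    (h1 : PairsNonneg W (fun _ => 1)) {K : V → V → ℝ} (hK : ∀ v v', 0 ≤ K v v') :
    PairsNonneg W (fun σ => Real.exp (replicaEnergy K σ)) := by
  intro e
  refine sum_mul_exp_nonneg _ _ _ fun N => ?_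
  have hpow : ∀ M : ℕ, PairsNonneg W (fun σ => (1 + replicaEnergy K σ / N) ^ M) := by
    intro M
    induction M with
    | zero => simpa using h1
    | succ M ih =>
      have h := ih.add ((ih.replicaEnergy_mul hK).const_mul
        (inv_nonneg.2 (Nat.cast_nonneg (α := ℝ) N)))
      refine (congrArg (PairsNonneg W) (funext fun σ => ?_)).mp h
      ring
  exact hpow N e

theorem pairsNonneg_one {w : V → ℤ → ℝ} (h0 : ∀ v, 0 ≤ w v (-1)) (h1 : ∀ v, w v (-1) ≤ w v 1) :
    PairsNonneg (fun σ : Fin 4 → V → ℤ => ∏ v, ∏ r, w v (σ r v)) (fun _ => 1) := by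
  intro e
  have h := sum_replicaConf_prod fun v q => (∏ r, w v (q r)) * ∏ k, rotSpin k q ^ e v k
  refine (Finset.prod_nonneg fun v _ =>
    site_moment_nonneg (w v) (h0 v) (h1 v) (e v)).trans_eq (h.symm.trans ?_)
  simp only [mul_one, Finset.prod_mul_distrib]

theorem sum_prod_isingWeight_nonneg (K : V → V → ℝ) (w : V → ℤ → ℝ)
    (F : (Fin 4 → V → ℤ) → ℝ) (h : PairsNonneg (fun σ : Fin 4 → V → ℤ => ∏ v, ∏ r, w v (σ r v))
      (fun σ => F σ * Real.exp (replicaEnergy K σ))) :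
    0 ≤ ∑ σ ∈ replicaConf V, (∏ r, isingWeight K w (σ r)) * F σ := by
  refine (h 0).trans_eq (Finset.sum_congr rfl fun σ _ => ?_)
  rw [prod_isingWeight]
  simp only [Pi.zero_apply, pow_zero, Finset.prod_const_one]
  ring

/-- Unnormalized Griffiths inequality: spins of a ferromagnet are nonnegatively correlated. -/
theorem ising_covariance_nonneg {K : V → V → ℝ} (hK : ∀ v v', 0 ≤ K v v') {w : V → ℤ → ℝ}
    (h0 : ∀ v, 0 ≤ w v (-1)) (h1 : ∀ v, w v (-1) ≤ w v 1)
    (hZ : 0 < ∑ a ∈ spinConf V, isingWeight K w a) (i j : V) :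
    0 ≤ (∑ a ∈ spinConf V, isingWeight K w a) *
        (∑ a ∈ spinConf V, isingWeight K w a * ((a i : ℝ) * a j))
      - (∑ a ∈ spinConf V, isingWeight K w a * (a i : ℝ)) *
        (∑ a ∈ spinConf V, isingWeight K w a * (a j : ℝ)) := by
  have hP := (((pairsNonneg_one h0 h1).exp_replicaEnergy hK).rotSpin_mul j 1).rotSpin_mul i 1
  simp only [← mul_assoc] at hP
  have h := sum_prod_isingWeight_nonneg K w _ hP
  have e := hadamard_covariance (spinConf V) (isingWeight K w) (fun a => (a i : ℝ))
    (fun a => (a j : ℝ))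
  have h' := h.trans_eq e
  exact nonneg_of_mul_nonneg_right h' (by positivity)

/-- Unnormalized Griffiths–Hurst–Sherman inequality: third cumulants are nonpositive. -/
theorem ising_cumulant_nonpos {K : V → V → ℝ} (hK : ∀ v v', 0 ≤ K v v') {w : V → ℤ → ℝ}
    (h0 : ∀ v, 0 ≤ w v (-1)) (h1 : ∀ v, w v (-1) ≤ w v 1)
    (hZ : 0 < ∑ a ∈ spinConf V, isingWeight K w a) (i j k : V) :
    (∑ a ∈ spinConf V, isingWeight K w a) ^ 2 *
        (∑ a ∈ spinConf V, isingWeight K w a * ((a i : ℝ) * ((a j : ℝ) * a k)))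
      - (∑ a ∈ spinConf V, isingWeight K w a) *
        ((∑ a ∈ spinConf V, isingWeight K w a * (a i : ℝ)) *
            (∑ a ∈ spinConf V, isingWeight K w a * ((a j : ℝ) * a k))
          + (∑ a ∈ spinConf V, isingWeight K w a * (a j : ℝ)) *
            (∑ a ∈ spinConf V, isingWeight K w a * ((a i : ℝ) * a k))
          + (∑ a ∈ spinConf V, isingWeight K w a * (a k : ℝ)) *
            (∑ a ∈ spinConf V, isingWeight K w a * ((a i : ℝ) * a j)))
      + 2 * (∑ a ∈ spinConf V, isingWeight K w a * (a i : ℝ)) *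
        (∑ a ∈ spinConf V, isingWeight K w a * (a j : ℝ)) *
        (∑ a ∈ spinConf V, isingWeight K w a * (a k : ℝ)) ≤ 0 := by
  have hP := ((((pairsNonneg_one h0 h1).exp_replicaEnergy hK).rotSpin_mul k 3).rotSpin_mul
    j 2).rotSpin_mul i 1
  simp only [← mul_assoc] at hP
  have h := sum_prod_isingWeight_nonneg K w _ hP
  simp only [mul_assoc (rotSpin 1 _)] at h
  have e := hadamard_cumulant (spinConf V) (isingWeight K w) (fun a => (a i : ℝ))
    (fun a => (a j : ℝ)) (fun a => (a k : ℝ))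
  have h' := h.trans_eq e
  by_contra! hc
  nlinarith [mul_pos hZ hc]

end Replicas

/-- Conditioning a positively correlated triple of `±1` variables with nonpositive third
cumulant on `x_k = 1` lowers the effect on `x_u` of conditioning on `x_j = 1`; all moments are
unnormalized, with `z` the total mass. -/
theorem conditional_gain_le {z u j k uj uk jk ujk : ℝ} (hz : 0 < z) (hj : 0 < z + j)
    (hk : 0 < z + k) (hjk : 0 < z + j + k + jk) (cuj : 0 ≤ z * uj - u * j)
    (cuk : 0 ≤ z * uk - u * k) (cjk : 0 ≤ z * jk - j * k)
    (ghs : z ^ 2 * ujk - z * (u * jk + j * uk + k * uj) + 2 * u * j * k ≤ 0) :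
    (u + uj + uk + ujk) / (z + j + k + jk) - (u + uk) / (z + k) ≤
      (u + uj) / (z + j) - u / z := by
  have hl : (u + uj + uk + ujk) / (z + j + k + jk) - (u + uk) / (z + k) =
      ((uj + ujk) * (z + k) - (u + uk) * (j + jk)) / ((z + k) * (z + j + k + jk)) := by
    field_simp
    ring
  have hr : (u + uj) / (z + j) - u / z = (z * uj - u * j) / (z * (z + j)) := by
    field_simp
    ring
  have h1 : z ^ 2 * ((uj + ujk) * (z + k) - (u + uk) * (j + jk)) ≤
      (z * uj - u * j) * (z + k) ^ 2 := by
    have := mul_nonneg cuk cjk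
    have := mul_nonneg hk.le (neg_nonneg.2 ghs)
    nlinarith
  have h2 : (z + k) * (z + j) ≤ z * (z + j + k + jk) := by nlinarith
  rw [hl, hr, div_le_div_iff₀ (by positivity) (by positivity)]
  have h3 := mul_le_mul_of_nonneg_right h1 hj.le
  have h4 := mul_le_mul_of_nonneg_left h2 (mul_nonneg cuj hk.le)
  have h5 : z * (((uj + ujk) * (z + k) - (u + uk) * (j + jk)) * (z * (z + j))) ≤
      z * ((z * uj - u * j) * ((z + k) * (z + j + k + jk))) := by nlinarith
  exact le_of_mul_le_mul_left h5 hz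

section Pinned

variable {n m : ℕ}

/-- The visible marginal without its normalizing constant. -/
noncomputable def visWeight (J : Matrix (Fin n) (Fin m) ℝ) (f : Fin n → ℝ) (g : Fin m → ℝ)
    (x : Fin n → ℤ) : ℝ :=
  ∑ y ∈ cube m, rbmWeight J f g x y

/-- The unnormalized expectation of `F` restricted to the event that `X_S` is all ones. -/
noncomputable def pinnedSum (J : Matrix (Fin n) (Fin m) ℝ) (f : Fin n → ℝ) (g : Fin m → ℝ)
    (S : Finset (Fin n)) (F : (Fin n → ℤ) → ℝ) : ℝ :=
  ∑ x ∈ eventS S (fun _ => 1), visWeight J f g x * F x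

theorem cube_nonempty (n : ℕ) : (cube n).Nonempty :=
  ⟨fun _ => 1, Fintype.mem_piFinset.2 fun _ => by simp⟩

theorem visWeight_pos (J : Matrix (Fin n) (Fin m) ℝ) (f : Fin n → ℝ) (g : Fin m → ℝ)
    (x : Fin n → ℤ) : 0 < visWeight J f g x :=
  Finset.sum_pos (fun _ _ => Real.exp_pos _) (cube_nonempty m)

theorem pinnedSum_one_pos (J : Matrix (Fin n) (Fin m) ℝ) (f : Fin n → ℝ) (g : Fin m → ℝ)
    (S : Finset (Fin n)) : 0 < pinnedSum J f g S (fun _ => 1) := by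
  refine Finset.sum_pos (fun x _ => by simpa using visWeight_pos J f g x)
    ⟨fun _ => 1, Finset.mem_filter.2 ⟨?_, fun _ _ => rfl⟩⟩
  exact Fintype.mem_piFinset.2 fun _ => by simp

theorem influence_eq_pinnedSum_div (J : Matrix (Fin n) (Fin m) ℝ) (f : Fin n → ℝ)
    (g : Fin m → ℝ) (u : Fin n) (S : Finset (Fin n)) :
    influence J f g u S =
      pinnedSum J f g S (fun x => (x u : ℝ)) / pinnedSum J f g S (fun _ => 1) := by
  have hZ : 0 < rbmZ J f g :=
    Finset.sum_pos (fun x _ => visWeight_pos J f g x) (cube_nonempty n)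
  have h : ∀ F : (Fin n → ℤ) → ℝ, ∑ x ∈ eventS S (fun _ => 1), F x * visP J f g x =
      pinnedSum J f g S F / rbmZ J f g := by
    intro F
    rw [pinnedSum, Finset.sum_div]
    refine Finset.sum_congr rfl fun x _ => ?_
    rw [visP, visWeight]
    ring
  have h1 := h fun _ => 1
  simp only [one_mul] at h1
  rw [influence, condExpVis, visPr, h, h1, div_div_div_cancel_right₀ hZ.ne']

theorem pinnedSum_insert (J : Matrix (Fin n) (Fin m) ℝ) (f : Fin n → ℝ) (g : Fin m → ℝ)
    (S : Finset (Fin n)) (j : Fin n) (F : (Fin n → ℤ) → ℝ) :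
    2 * pinnedSum J f g (insert j S) F =
      pinnedSum J f g S F + pinnedSum J f g S (fun x => F x * (x j : ℝ)) := by
  have he : eventS (insert j S) (fun _ => 1) =
      (eventS S (fun _ => 1)).filter fun x : Fin n → ℤ => x j = 1 := by
    ext x
    simp only [eventS, Finset.mem_filter, Finset.forall_mem_insert]
    tauto
  simp only [pinnedSum]
  rw [he, Finset.sum_filter, Finset.mul_sum, ← Finset.sum_add_distrib]
  refine Finset.sum_congr rfl fun x hx => ?_
  have hx' := Fintype.mem_piFinset.1 (Finset.mem_filter.1 hx).1 j
  simp only [Finset.mem_insert, Finset.mem_singleton] at hx'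
  rcases hx' with h | h
  · simp [h]
    ring
  · simp [h]

/-- Couplings of an RBM viewed as an Ising model on the disjoint union of its two layers. -/
def bipartiteCoupling (J : Matrix (Fin n) (Fin m) ℝ) : Fin n ⊕ Fin m → Fin n ⊕ Fin m → ℝ
  | .inl i, .inr j => J i j
  | _, _ => 0

/-- Single-site weights of an RBM in which the visible nodes in `S` are forced to be `1`. -/
noncomputable def pinnedSiteWeight (f : Fin n → ℝ) (g : Fin m → ℝ) (S : Finset (Fin n)) :
    Fin n ⊕ Fin m → ℤ → ℝ
  | .inl i, t => if i ∈ S → t = 1 then Real.exp (f i * t) else 0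
  | .inr j, t => Real.exp (g j * t)

theorem isingWeight_sumElim (J : Matrix (Fin n) (Fin m) ℝ) (f : Fin n → ℝ) (g : Fin m → ℝ)
    (S : Finset (Fin n)) (x : Fin n → ℤ) (y : Fin m → ℤ) :
    isingWeight (bipartiteCoupling J) (pinnedSiteWeight f g S) (Sum.elim x y) =
      if ∀ i ∈ S, x i = 1 then rbmWeight J f g x y else 0 := by
  have hvis : ∏ i, pinnedSiteWeight f g S (.inl i) (x i) =
      if ∀ i ∈ S, x i = 1 then Real.exp (∑ i, f i * x i) else 0 := by
    simp only [pinnedSiteWeight]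
    split_ifs with h
    · rw [Real.exp_sum]
      exact Finset.prod_congr rfl fun i _ => if_pos (h i)
    · push Not at h
      obtain ⟨i, hi, hne⟩ := h
      exact Finset.prod_eq_zero (Finset.mem_univ i) (if_neg fun h => hne (h hi))
  simp only [isingWeight, Fintype.prod_sum_type, Fintype.sum_sum_type, Sum.elim_inl,
    Sum.elim_inr, hvis, bipartiteCoupling, zero_mul, Finset.sum_const_zero, zero_add, add_zero]
  split_ifs with h
  · simp only [pinnedSiteWeight, rbmWeight, ← Real.exp_sum, ← Real.exp_add]
    congr 1
    have : ∑ i, ∑ j, J i j * ((x i : ℝ) * y j) = ∑ i, ∑ j, (x i : ℝ) * J i j * y j :=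
      Finset.sum_congr rfl fun i _ => Finset.sum_congr rfl fun j _ => by ring
    rw [this]
    ring
  · simp

theorem sum_spinConf_sumElim (H : (Fin n ⊕ Fin m → ℤ) → ℝ) :
    ∑ z ∈ spinConf (Fin n ⊕ Fin m), H z = ∑ x ∈ cube n, ∑ y ∈ cube m, H (Sum.elim x y) := by
  rw [← Finset.sum_product']
  refine Finset.sum_nbij' (fun z => (z ∘ Sum.inl, z ∘ Sum.inr)) (fun p => Sum.elim p.1 p.2)
    ?_ ?_ ?_ ?_ ?_
  · intro z hz
    have h := Fintype.mem_piFinset.1 hz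
    exact Finset.mem_product.2
      ⟨Fintype.mem_piFinset.2 fun i => h (.inl i), Fintype.mem_piFinset.2 fun i => h (.inr i)⟩
  · intro p hp
    have h := Finset.mem_product.1 hp
    refine Fintype.mem_piFinset.2 fun v => ?_
    cases v with
    | inl i => exact Fintype.mem_piFinset.1 h.1 i
    | inr i => exact Fintype.mem_piFinset.1 h.2 i
  · intro z _
    exact Sum.elim_comp_inl_inr z
  · intro p _
    rfl
  · intro z _
    rw [Sum.elim_comp_inl_inr]

theorem pinnedSum_eq_ising (J : Matrix (Fin n) (Fin m) ℝ) (f : Fin n → ℝ) (g : Fin m → ℝ)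
    (S : Finset (Fin n)) (F : (Fin n → ℤ) → ℝ) :
    pinnedSum J f g S F = ∑ z ∈ spinConf (Fin n ⊕ Fin m),
      isingWeight (bipartiteCoupling J) (pinnedSiteWeight f g S) z * F (z ∘ Sum.inl) := by
  rw [sum_spinConf_sumElim, pinnedSum, eventS, Finset.sum_filter]
  refine Finset.sum_congr rfl fun x _ => ?_
  simp only [isingWeight_sumElim, Sum.elim_comp_inl, ← Finset.sum_mul]
  split_ifs <;> simp [visWeight]

theorem influence_insert_insert_sub_le (J : Matrix (Fin n) (Fin m) ℝ) (f : Fin n → ℝ)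
    (g : Fin m → ℝ) (hJ : ∀ i j, 0 ≤ J i j) (hf : ∀ i, 0 ≤ f i) (hg : ∀ j, 0 ≤ g j)
    (u j k : Fin n) (S : Finset (Fin n)) :
    influence J f g u (insert j (insert k S)) - influence J f g u (insert k S) ≤
      influence J f g u (insert j S) - influence J f g u S := by
  have hK : ∀ v v', 0 ≤ bipartiteCoupling J v v' := by
    rintro (i | i) (i' | i') <;> simp [bipartiteCoupling, hJ]
  have h0 : ∀ v, 0 ≤ pinnedSiteWeight f g S v (-1) := by
    rintro (i | i) <;> simp only [pinnedSiteWeight]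
    · split_ifs <;> positivity
    · positivity
  have h1 : ∀ v, pinnedSiteWeight f g S v (-1) ≤ pinnedSiteWeight f g S v 1 := by
    rintro (i | i) <;> simp only [pinnedSiteWeight]
    · have := hf i
      have hle : Real.exp (f i * ((-1 : ℤ) : ℝ)) ≤ Real.exp (f i * ((1 : ℤ) : ℝ)) := by
        gcongr
        norm_num
      simp only [implies_true, if_true]
      exact (ite_le_sup _ _ _).trans (sup_le hle (Real.exp_nonneg _))
    · have := hg i
      gcongr
      norm_num
  have hZ := pinnedSum_one_pos J f g S
  have hZj := pinnedSum_one_pos J f g (insert j S)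
  have hZk := pinnedSum_one_pos J f g (insert k S)
  have hZjk := pinnedSum_one_pos J f g (insert j (insert k S))
  have hZ' := hZ
  rw [pinnedSum_eq_ising] at hZ'
  simp only [mul_one] at hZ'
  have cov := ising_covariance_nonneg hK h0 h1 hZ'
  have ghs := ising_cumulant_nonpos hK h0 h1 hZ' (.inl u) (.inl j) (.inl k)
  have cuj := cov (.inl u) (.inl j)
  have cuk := cov (.inl u) (.inl k)
  have cjk := cov (.inl j) (.inl k)
  have ez := pinnedSum_eq_ising J f g S fun _ => 1
  simp only [mul_one] at ez
  have e1 := fun v => pinnedSum_eq_ising J f g S fun x => (x v : ℝ)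
  have e2 := fun v v' => pinnedSum_eq_ising J f g S fun x => (x v : ℝ) * (x v' : ℝ)
  have e3 := fun v v' v'' =>
    pinnedSum_eq_ising J f g S fun x => (x v : ℝ) * ((x v' : ℝ) * (x v'' : ℝ))
  simp only [Function.comp_apply] at e1 e2 e3
  simp only [← ez, ← e1, ← e2, ← e3] at ghs cuj cuk cjk
  have i1 := pinnedSum_insert J f g S
  have i2 := pinnedSum_insert J f g (insert k S)
  have hj := i1 j fun _ => 1
  have hk := i1 k fun _ => 1
  have huj := i1 j fun x => (x u : ℝ)
  have huk := i1 k fun x => (x u : ℝ)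
  have hjk := i2 j fun _ => 1
  have hujk := i2 j fun x => (x u : ℝ)
  have hjk' := i1 k fun x => (x j : ℝ)
  have hujk' := i1 k fun x => (x u : ℝ) * (x j : ℝ)
  simp only [one_mul, mul_assoc] at hj hk huj huk hjk hujk hjk' hujk'
  have ratio : ∀ a b c d : ℝ, a = 2 * b → c = 2 * d → b / d = a / c := by
    rintro a b c d rfl rfl
    rw [mul_div_mul_left _ _ two_ne_zero]
  have ratio4 : ∀ a b c d : ℝ, a = 4 * b → c = 4 * d → b / d = a / c := by
    rintro a b c d rfl rfl
    rw [mul_div_mul_left _ _ four_ne_zero]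
  simp only [influence_eq_pinnedSum_div]
  rw [ratio _ _ _ _ huj.symm hj.symm, ratio _ _ _ _ huk.symm hk.symm,
    ratio4 (pinnedSum J f g S (fun x => (x u : ℝ)) +
      pinnedSum J f g S (fun x => (x u : ℝ) * (x j : ℝ)) +
      pinnedSum J f g S (fun x => (x u : ℝ) * (x k : ℝ)) +
      pinnedSum J f g S (fun x => (x u : ℝ) * ((x j : ℝ) * (x k : ℝ)))) _
      (pinnedSum J f g S (fun _ => 1) + pinnedSum J f g S (fun x => (x j : ℝ)) +
      pinnedSum J f g S (fun x => (x k : ℝ)) +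
      pinnedSum J f g S (fun x => (x j : ℝ) * (x k : ℝ))) _ (by linarith) (by linarith)]
  exact conditional_gain_le hZ (by linarith) (by linarith) (by linarith) cuj cuk cjk ghs

end Pinned

/-- For a ferromagnetic RBM `(J, f, g)` and a visible node `u`, the discrete
influence function `S ↦ I_u(S)` is submodular: for all `S ⊆ T ⊆ [n] \ {u}` and every
`j ∉ T ∪ {u}`, `I_u(S ∪ {j}) − I_u(S) ≥ I_u(T ∪ {j}) − I_u(T)`. -/
theorem influence_submodular {n m : ℕ} (J : Matrix (Fin n) (Fin m) ℝ)
    (f : Fin n → ℝ) (g : Fin m → ℝ)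
    (hJ : ∀ i j, 0 ≤ J i j) (hf : ∀ i, 0 ≤ f i) (hg : ∀ j, 0 ≤ g j)
    (u : Fin n) (S T : Finset (Fin n)) (hST : S ⊆ T) (hu : u ∉ T)
    (j : Fin n) (hjT : j ∉ T) (hju : j ≠ u) :
    influence J f g u (insert j T) - influence J f g u T ≤
      influence J f g u (insert j S) - influence J f g u S := by
  have key : ∀ R : Finset (Fin n),
      influence J f g u (insert j (R ∪ S)) - influence J f g u (R ∪ S) ≤
        influence J f g u (insert j S) - influence J f g u S := by
    intro R
    induction R using Finset.induction_on with
    | empty => rw [Finset.empty_union]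
    | insert k R _ ih =>
      rw [Finset.insert_union]
      exact (influence_insert_insert_sub_le J f g hJ hf hg u j k (R ∪ S)).trans ih
  simpa only [Finset.union_eq_left.2 hST] using key T
end

section
/- Let (J,f,g) be a locally consistent RBM with n visible nodes. Then for all distinct visible nodes u, v ∈ [n] and every S ⊆ [n]\{u,v}, the average conditional covariance is nonnegative: Cov^avg(u,v|S) ≥ 0. -/
open Finset

open scoped FinsetFamily

theorem Real.cosh_mul_cosh_le_of_add_eq {a b c d : ℝ} (hadd : a + b = c + d)
    (hsub : |a - b| ≤ |c - d|) : cosh a * cosh b ≤ cosh c * cosh d := by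
  have h := cosh_le_cosh.2 hsub
  have h1 : cosh (a + b) = cosh (c + d) := by rw [hadd]
  rw [cosh_add, cosh_add] at h1
  rw [cosh_sub, cosh_sub] at h
  linarith

theorem sum_mul_inf_add_sum_mul_sup {n : ℕ} (a : Fin n → ℝ) (x y : Fin n → ℤ) :
    ∑ i, a i * (x i : ℝ) + ∑ i, a i * (y i : ℝ) =
      ∑ i, a i * ((x ⊓ y) i : ℝ) + ∑ i, a i * ((x ⊔ y) i : ℝ) := by
  rw [← Finset.sum_add_distrib, ← Finset.sum_add_distrib]
  refine Finset.sum_congr rfl fun i _ => ?_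
  rw [← mul_add, ← mul_add]
  congr 1
  exact_mod_cast (inf_add_sup (x i) (y i)).symm

theorem abs_sum_mul_sub_le_sup_sub_inf {n : ℕ} {a : Fin n → ℝ} (ha : ∀ i, 0 ≤ a i)
    (x y : Fin n → ℤ) :
    |∑ i, a i * (x i : ℝ) - ∑ i, a i * (y i : ℝ)| ≤
      ∑ i, a i * ((x ⊔ y) i : ℝ) - ∑ i, a i * ((x ⊓ y) i : ℝ) := by
  rw [← Finset.sum_sub_distrib, ← Finset.sum_sub_distrib]
  refine (Finset.abs_sum_le_sum_abs _ _).trans_eq (Finset.sum_congr rfl fun i _ => ?_)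
  rw [← mul_sub, ← mul_sub, abs_mul, abs_of_nonneg (ha i)]
  congr 1
  rw [abs_sub_comm]
  exact_mod_cast (sup_sub_inf_eq_abs_sub (x i) (y i)).symm

theorem cosh_sum_mul_le_inf_sup {n : ℕ} {a : Fin n → ℝ}
    (ha : (∀ i, 0 ≤ a i) ∨ ∀ i, a i ≤ 0) (t : ℝ) (x y : Fin n → ℤ) :
    Real.cosh (∑ i, a i * (x i : ℝ) + t) * Real.cosh (∑ i, a i * (y i : ℝ) + t) ≤
      Real.cosh (∑ i, a i * ((x ⊓ y) i : ℝ) + t) *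
        Real.cosh (∑ i, a i * ((x ⊔ y) i : ℝ) + t) := by
  wlog h : ∀ i, 0 ≤ a i generalizing a t
  · have hneg : ∀ z : Fin n → ℤ, Real.cosh (∑ i, -a i * (z i : ℝ) + -t) =
        Real.cosh (∑ i, a i * (z i : ℝ) + t) := fun z => by
      rw [← Real.cosh_neg]
      congr 1
      simp only [neg_mul, Finset.sum_neg_distrib]
      ring
    have hnonneg : ∀ i, 0 ≤ -a i := fun i => neg_nonneg.2 (ha.resolve_left h i)
    simpa only [hneg] using this (Or.inl hnonneg) (-t) hnonneg
  refine Real.cosh_mul_cosh_le_of_add_eq ?_ ?_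
  · linarith [sum_mul_inf_add_sum_mul_sup a x y]
  · rw [abs_sub_comm (∑ i, a i * ((x ⊓ y) i : ℝ) + t), add_sub_add_right_eq_sub,
      add_sub_add_right_eq_sub]
    exact (abs_sum_mul_sub_le_sup_sub_inf h x y).trans (le_abs_self _)

theorem sum_rbmWeight_eq_prod_cosh {n m : ℕ} (J : Matrix (Fin n) (Fin m) ℝ)
    (f : Fin n → ℝ) (g : Fin m → ℝ) (x : Fin n → ℤ) :
    ∑ y ∈ cube m, rbmWeight J f g x y =
      Real.exp (∑ i, f i * (x i : ℝ)) *
        ∏ j, (2 * Real.cosh (∑ i, J i j * (x i : ℝ) + g j)) := by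
  have hcosh : ∀ j, 2 * Real.cosh (∑ i, J i j * (x i : ℝ) + g j) =
      ∑ s ∈ ({1, -1} : Finset ℤ), Real.exp ((∑ i, J i j * (x i : ℝ) + g j) * (s : ℝ)) := by
    intro j
    rw [Finset.sum_pair (by decide), Real.cosh_eq]
    push_cast
    rw [mul_one, mul_neg_one]
    ring
  simp only [hcosh]
  rw [Finset.prod_univ_sum, Finset.mul_sum]
  refine Finset.sum_congr rfl fun y _ => ?_
  rw [← Real.exp_sum, ← Real.exp_add, rbmWeight, Finset.sum_comm]
  congr 1
  simp only [add_mul, Finset.sum_add_distrib, Finset.sum_mul]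
  simp only [mul_comm ((x _ : ℤ) : ℝ)]
  ring

theorem visP_nonneg {n m : ℕ} (J : Matrix (Fin n) (Fin m) ℝ) (f : Fin n → ℝ) (g : Fin m → ℝ)
    (x : Fin n → ℤ) : 0 ≤ visP J f g x :=
  div_nonneg (Finset.sum_nonneg fun _ _ => (Real.exp_pos _).le)
    (Finset.sum_nonneg fun _ _ => Finset.sum_nonneg fun _ _ => (Real.exp_pos _).le)

/-- The visible marginal of a locally consistent RBM is log-supermodular. -/
theorem visP_mul_visP_le_inf_sup {n m : ℕ} {J : Matrix (Fin n) (Fin m) ℝ}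
    (f : Fin n → ℝ) (g : Fin m → ℝ)
    (hloc : ∀ j : Fin m, (∀ i, 0 ≤ J i j) ∨ (∀ i, J i j ≤ 0)) (x y : Fin n → ℤ) :
    visP J f g x * visP J f g y ≤ visP J f g (x ⊓ y) * visP J f g (x ⊔ y) := by
  simp only [visP, sum_rbmWeight_eq_prod_cosh]
  rw [div_mul_div_comm, div_mul_div_comm]
  refine div_le_div_of_nonneg_right ?_ (mul_self_nonneg _)
  rw [mul_mul_mul_comm, mul_mul_mul_comm (Real.exp (∑ i, f i * ((x ⊓ y) i : ℝ))),
    ← Real.exp_add, ← Real.exp_add, sum_mul_inf_add_sum_mul_sup,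
    ← Finset.prod_mul_distrib, ← Finset.prod_mul_distrib]
  have hpos : ∀ j (z : Fin n → ℤ), 0 ≤ 2 * Real.cosh (∑ i, J i j * (z i : ℝ) + g j) :=
    fun j z => mul_nonneg zero_le_two (Real.cosh_pos _).le
  refine mul_le_mul_of_nonneg_left (Finset.prod_le_prod
    (fun j _ => mul_nonneg (hpos j x) (hpos j y)) fun j _ => ?_) (Real.exp_pos _).le
  linarith [cosh_sum_mul_le_inf_sup (hloc j) (g j) x y]

theorem mem_eventS {n : ℕ} {S : Finset (Fin n)} {c x : Fin n → ℤ} :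
    x ∈ eventS S c ↔ (∀ i, x i = 1 ∨ x i = -1) ∧ ∀ j ∈ S, x j = c j := by
  simp [eventS, cube]

theorem infs_eventS_subset {n : ℕ} (S : Finset (Fin n)) (c : Fin n → ℤ) :
    eventS S c ⊼ eventS S c ⊆ eventS S c := by
  refine Finset.infs_subset_iff.2 fun x hx y hy => ?_
  rw [mem_eventS] at *
  refine ⟨fun i => ?_, fun j hj => ?_⟩
  · rcases min_choice (x i) (y i) with h | h <;> simp [h, hx.1 i, hy.1 i]
  · simp [hx.2 j hj, hy.2 j hj]

theorem sups_eventS_subset {n : ℕ} (S : Finset (Fin n)) (c : Fin n → ℤ) :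
    eventS S c ⊻ eventS S c ⊆ eventS S c := by
  refine Finset.sups_subset_iff.2 fun x hx y hy => ?_
  rw [mem_eventS] at *
  refine ⟨fun i => ?_, fun j hj => ?_⟩
  · rcases max_choice (x i) (y i) with h | h <;> simp [h, hx.1 i, hy.1 i]
  · simp [hx.2 j hj, hy.2 j hj]

/-- The FKG inequality for a log-supermodular weight on a finite sublattice. -/
theorem fkg_of_sublattice {α : Type*} [DistribLattice α] [DecidableEq α] {s : Finset α}
    (hinf : s ⊼ s ⊆ s) (hsup : s ⊻ s ⊆ s) {w F G : α → ℝ}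
    (hw : ∀ a, 0 ≤ w a) (hF : ∀ a, 0 ≤ F a) (hG : ∀ a, 0 ≤ G a)
    (hFm : Monotone F) (hGm : Monotone G)
    (hlog : ∀ a b, w a * w b ≤ w (a ⊓ b) * w (a ⊔ b)) :
    (∑ a ∈ s, F a * w a) * ∑ a ∈ s, G a * w a ≤
      (∑ a ∈ s, w a) * ∑ a ∈ s, F a * G a * w a := by
  have h := four_functions_theorem (f₁ := fun a => F a * w a) (f₂ := fun a => G a * w a)
    (f₃ := w) (f₄ := fun a => F a * G a * w a)
    (fun a => mul_nonneg (hF a) (hw a)) (fun a => mul_nonneg (hG a) (hw a)) hw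
    (fun a => mul_nonneg (mul_nonneg (hF a) (hG a)) (hw a)) (fun a b => by
      calc F a * w a * (G b * w b) = F a * G b * (w a * w b) := by ring
        _ ≤ F (a ⊔ b) * G (a ⊔ b) * (w (a ⊓ b) * w (a ⊔ b)) :=
          mul_le_mul (mul_le_mul (hFm le_sup_left) (hGm le_sup_right) (hG _) (hF _))
            (hlog a b) (mul_nonneg (hw _) (hw _)) (mul_nonneg (hF _) (hG _))
        _ = w (a ⊓ b) * (F (a ⊔ b) * G (a ⊔ b) * w (a ⊔ b)) := by ring) s s
  refine h.trans (mul_le_mul ?_ ?_ ?_ ?_)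
  · exact Finset.sum_le_sum_of_subset_of_nonneg hinf fun a _ _ => hw a
  · exact Finset.sum_le_sum_of_subset_of_nonneg hsup fun a _ _ =>
      mul_nonneg (mul_nonneg (hF a) (hG a)) (hw a)
  · exact Finset.sum_nonneg fun a _ => mul_nonneg (mul_nonneg (hF a) (hG a)) (hw a)
  · exact Finset.sum_nonneg fun a _ => hw a

theorem condCov_nonneg {n m : ℕ} {J : Matrix (Fin n) (Fin m) ℝ}
    (f : Fin n → ℝ) (g : Fin m → ℝ)
    (hloc : ∀ j : Fin m, (∀ i, 0 ≤ J i j) ∨ (∀ i, J i j ≤ 0))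
    (u v : Fin n) (S : Finset (Fin n)) (c : Fin n → ℤ) :
    0 ≤ condCov J f g u v S c := by
  have hmono : ∀ i : Fin n, Monotone fun x : Fin n → ℤ => max (1 + (x i : ℝ)) 0 :=
    fun i x y hxy => max_le_max (by have := hxy i; gcongr) le_rfl
  have hfkg := fkg_of_sublattice (infs_eventS_subset S c) (sups_eventS_subset S c)
    (visP_nonneg J f g) (fun _ => le_max_right _ _) (fun _ => le_max_right _ _)
    (hmono u) (hmono v) (visP_mul_visP_le_inf_sup f g hloc)
  have hshift : ∀ x ∈ eventS S c, ∀ i, max (1 + (x i : ℝ)) 0 = 1 + (x i : ℝ) := by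
    intro x hx i
    rcases (mem_eventS.1 hx).1 i with h | h <;> norm_num [h]
  have hone : ∀ i, ∑ x ∈ eventS S c, max (1 + (x i : ℝ)) 0 * visP J f g x =
      ∑ x ∈ eventS S c, visP J f g x + ∑ x ∈ eventS S c, (x i : ℝ) * visP J f g x := by
    intro i
    rw [← Finset.sum_add_distrib]
    refine Finset.sum_congr rfl fun x hx => ?_
    rw [hshift x hx]
    ring
  have htwo : ∑ x ∈ eventS S c,
      max (1 + (x u : ℝ)) 0 * max (1 + (x v : ℝ)) 0 * visP J f g x =
      ∑ x ∈ eventS S c, visP J f g x + ∑ x ∈ eventS S c, (x u : ℝ) * visP J f g x +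
        ∑ x ∈ eventS S c, (x v : ℝ) * visP J f g x +
        ∑ x ∈ eventS S c, (x u : ℝ) * (x v : ℝ) * visP J f g x := by
    simp only [← Finset.sum_add_distrib]
    refine Finset.sum_congr rfl fun x hx => ?_
    rw [hshift x hx, hshift x hx]
    ring
  rw [hone, hone, htwo] at hfkg
  simp only [condCov, condExpVis, visPr]
  set P := ∑ x ∈ eventS S c, visP J f g x
  rcases eq_or_ne P 0 with h0 | h0
  · simp [h0]
  · rw [sub_nonneg, div_mul_div_comm, ← mul_div_mul_left _ P h0]
    exact div_le_div_of_nonneg_right (by linarith) (mul_self_nonneg P)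

/-- For a locally consistent RBM, the average conditional covariance is
nonnegative: `Cov^avg(u, v | S) ≥ 0` for all distinct visible nodes `u, v` and every
`S ⊆ [n] \ {u, v}`. -/
theorem avgCondCov_nonneg {n m : ℕ} (J : Matrix (Fin n) (Fin m) ℝ)
    (f : Fin n → ℝ) (g : Fin m → ℝ)
    (hloc : ∀ j : Fin m, (∀ i, 0 ≤ J i j) ∨ (∀ i, J i j ≤ 0))
    (u v : Fin n) (huv : u ≠ v)
    (S : Finset (Fin n)) (hu : u ∉ S) (hv : v ∉ S) :
    0 ≤ avgCondCov J f g u v S := by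
  exact Finset.sum_nonneg fun c _ => mul_nonneg
    (Finset.sum_nonneg fun x _ => visP_nonneg J f g x) (condCov_nonneg f g hloc u v S c)
end
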